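/- The number of ways to write a fixed n-cycle in S_n as an ordered product of n-1 transpositions is n^{n-2}. -/

import Mathlib

open Equiv Equiv.Perm
open scoped Nat

/-- Lower-degree case of the finite-difference formula, with the `k = 0` term left out. -/
lemma sum_range_neg_one_pow_mul_choose_mul_pow (m : ℕ) :
    ∑ k ∈ Finset.range (m + 1),
      (-1 : ℚ) ^ (m - k) * ((m + 1).choose (k + 1)) * ((k : ℚ) + 1) ^ m = 0 ^ m := by
  have h := fwdDiff_iter_pow_eq_zero_of_lt (R := ℚ) (Nat.lt_succ_self m)
  have h0 := congrFun h 0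
  rw [fwdDiff_iter_eq_sum_shift, Finset.sum_range_succ'] at h0
  simp only [Nat.succ_eq_add_one, Nat.add_sub_add_right, zero_add, nsmul_eq_mul, mul_one,
    zsmul_eq_mul, Nat.choose_zero_right, Nat.sub_zero, Nat.cast_zero, Pi.zero_apply] at h0
  push_cast at h0
  rcases Nat.eq_zero_or_pos m with rfl | hm
  · simp
  · rw [zero_pow hm.ne'] at h0 ⊢
    linarith

/-- A case of Abel's binomial identity. -/
lemma sum_choose_mul_pow_mul_pow (n : ℕ) :
    ∑ k ∈ Finset.range (n + 1),
      ((n + 1).choose (k + 1) : ℚ) * ((k : ℚ) + 1) ^ k * ((n : ℚ) - k) ^ (n - k)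
      = ((n : ℚ) + 1) ^ (n + 1) := by
  have key : ∀ k ∈ Finset.range (n + 1),
      ((n + 1).choose (k + 1) : ℚ) * ((k : ℚ) + 1) ^ k * ((n : ℚ) - k) ^ (n - k) =
      ∑ j ∈ Finset.range (n - k + 1), ((n : ℚ) + 1) ^ j * ((n + 1).choose j) *
        ((-1 : ℚ) ^ (n - j - k) * ((n - j + 1).choose (k + 1)) * ((k : ℚ) + 1) ^ (n - j)) := by
    intro k hk
    have hk' : k ≤ n := Nat.lt_succ_iff.mp (Finset.mem_range.mp hk)
    have e : (n : ℚ) - k = (n + 1) + (-1) * (k + 1) := by ring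
    rw [e, add_pow ((n : ℚ) + 1), Finset.mul_sum]
    refine Finset.sum_congr rfl fun j hj => ?_
    have hj' : j ≤ n - k := Nat.lt_succ_iff.mp (Finset.mem_range.mp hj)
    have hc : (n + 1).choose (k + 1) * (n - k).choose j =
        (n + 1).choose j * (n - j + 1).choose (k + 1) := by
      have h1 := Nat.choose_mul (n := n + 1) (k := k + 1 + j) (s := j) (by omega)
      have h2 := Nat.choose_mul (n := n + 1) (k := k + 1 + j) (s := k + 1) (by omega)
      have h3 : (k + 1 + j).choose j = (k + 1 + j).choose (k + 1) :=
        Nat.choose_symm_add.symm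
      rw [h3, h2] at h1
      convert h1 using 3 <;> omega
    have hc' : ((n + 1).choose (k + 1) : ℚ) * (n - k).choose j =
        (n + 1).choose j * (n - j + 1).choose (k + 1) := by exact_mod_cast hc
    have e1 : n - j - k = n - k - j := by omega
    have e2 : ((k : ℚ) + 1) ^ (n - j) = ((k : ℚ) + 1) ^ k * ((k : ℚ) + 1) ^ (n - k - j) := by
      rw [← pow_add]; congr 1; omega
    rw [mul_pow, e1, e2]
    linear_combination ((k : ℚ) + 1) ^ k * ((n : ℚ) + 1) ^ j * (-1) ^ (n - k - j) *
      ((k : ℚ) + 1) ^ (n - k - j) * hc'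
  rw [Finset.sum_congr rfl key, Finset.sum_comm' (t' := Finset.range (n + 1))
    (s' := fun j => Finset.range (n - j + 1)) (by intro x y; simp only [Finset.mem_range]; omega)]
  simp_rw [← Finset.mul_sum, sum_range_neg_one_pow_mul_choose_mul_pow]
  rw [Finset.sum_range_succ, Finset.sum_eq_zero]
  · simp [pow_succ]
  · intro j hj
    have : n - j ≠ 0 := by have := Finset.mem_range.mp hj; omega
    simp [this]

/-- `d ^ (d - 2) / (d - 1)!`, the contribution of a cycle of length `d`. -/
def cycleWeight (d : ℕ) : ℚ := (d : ℚ) ^ (d - 1) / d !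

lemma sum_cycleWeight_mul_cycleWeight (n : ℕ) :
    ∑ i ∈ Finset.range n, cycleWeight (i + 1) * cycleWeight (n - i) =
      2 * n / (n + 1) * cycleWeight (n + 1) := by
  have habel := sum_choose_mul_pow_mul_pow n
  rw [Finset.sum_range_succ] at habel
  have hT : ∀ i ∈ Finset.range n,
      ((n + 1).choose (i + 1) : ℚ) * ((i : ℚ) + 1) ^ i * ((n : ℚ) - i) ^ (n - i) =
      (n + 1)! * (((n : ℚ) - i) * (cycleWeight (i + 1) * cycleWeight (n - i))) := by
    intro i hi
    have hi := Finset.mem_range.mp hi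
    obtain ⟨d, rfl⟩ : ∃ d, n = i + 1 + d := ⟨n - i - 1, by omega⟩
    have e : i + 1 + d - i = d + 1 := by omega
    rw [Nat.cast_choose ℚ (by omega), e, show i + 1 + d + 1 - (i + 1) = d + 1 by omega]
    simp only [cycleWeight, Nat.add_sub_cancel]
    have h1 : ((i + 1)! : ℚ) ≠ 0 := by positivity
    have h2 : ((d + 1)! : ℚ) ≠ 0 := by positivity
    push_cast
    field_simp
    ring
  rw [Finset.sum_congr rfl hT, ← Finset.mul_sum] at habel
  have hrefl : ∑ i ∈ Finset.range n, ((n : ℚ) - i) * (cycleWeight (i + 1) * cycleWeight (n - i)) =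
      ∑ i ∈ Finset.range n, ((i : ℚ) + 1) * (cycleWeight (i + 1) * cycleWeight (n - i)) := by
    rw [← Finset.sum_range_reflect]
    refine Finset.sum_congr rfl fun i hi => ?_
    have hi := Finset.mem_range.mp hi
    obtain ⟨d, rfl⟩ : ∃ d, n = i + 1 + d := ⟨n - i - 1, by omega⟩
    rw [show i + 1 + d - 1 - i = d by omega, show i + 1 + d - d = i + 1 by omega,
      show i + 1 + d - i = d + 1 by omega]
    push_cast
    ring
  have hsum : ((n : ℚ) + 1) * ∑ i ∈ Finset.range n, cycleWeight (i + 1) * cycleWeight (n - i) =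
      2 * ∑ i ∈ Finset.range n, ((n : ℚ) - i) * (cycleWeight (i + 1) * cycleWeight (n - i)) := by
    rw [two_mul]
    nth_rw 2 [hrefl]
    rw [← Finset.sum_add_distrib, Finset.mul_sum]
    exact Finset.sum_congr rfl fun i _ => by ring
  have hf : ((n + 1)! : ℚ) ≠ 0 := by positivity
  have hn : (n : ℚ) + 1 ≠ 0 := by positivity
  have hw : cycleWeight (n + 1) * (n + 1)! = ((n : ℚ) + 1) ^ n := by
    simp [cycleWeight, div_mul_cancel₀ _ hf]
  simp only [Nat.choose_self, Nat.cast_one, one_mul, sub_self, Nat.sub_self, pow_zero,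
    mul_one] at habel
  rw [div_mul_eq_mul_div, eq_div_iff hn, mul_comm, hsum]
  apply mul_right_cancel₀ hf
  rw [pow_succ] at habel
  linear_combination 2 * habel - 2 * n * hw

section

variable {α : Type*} [DecidableEq α]

/-- Multiplying by a transposition cuts a cycle in two. -/
lemma formPerm_cons_append_cons (a : α) (l₁ : List α) (b : α) (l₂ : List α)
    (h : (a :: (l₁ ++ b :: l₂)).Nodup) :
    (a :: (l₁ ++ b :: l₂)).formPerm =
      swap a b * ((a :: l₁).formPerm * (b :: l₂).formPerm) := by
  induction l₁ generalizing a with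
  | nil => simp [List.formPerm_cons_cons]
  | cons c l₁ ih =>
    have hcb : c ≠ b := by rintro rfl; simp at h
    have hab : a ≠ b := by rintro rfl; simp at h
    have hac : a ≠ c := by rintro rfl; simp at h
    rw [List.cons_append, List.formPerm_cons_cons, ih c (List.nodup_cons.mp h).2,
      List.formPerm_cons_cons]
    have : swap a c * swap c b = swap a b * swap a c := by
      ext x
      simp only [Perm.mul_apply, swap_apply_def]
      grind
    simp only [← mul_assoc, this]

lemma sum_toFinset_of_forall_append {M : Type*} [AddCommMonoid M] (l : List α) (hl : l.Nodup)
    (f : α → M) (g : ℕ → M) (h : ∀ l₁ b l₂, l = l₁ ++ b :: l₂ → f b = g l₁.length) :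
    ∑ b ∈ l.toFinset, f b = ∑ i ∈ Finset.range l.length, g i := by
  rw [List.sum_toFinset f hl, Finset.sum_range, ← List.sum_ofFn]
  congr 1
  refine List.ext_getElem (by simp) fun i h₁ h₂ => ?_
  have hi : i < l.length := by simpa using h₁
  simp only [List.getElem_map, List.getElem_ofFn]
  rw [h (l.take i) l[i] (l.drop (i + 1)) (by simp)]
  simp [hi.le]

variable [Fintype α]

lemma exists_formPerm_mul (π : Perm α) (a : α) :
    ∃ (l : List α) (r : Perm α), (a :: l).Nodup ∧ π = (a :: l).formPerm * r ∧
      (∀ x ∈ a :: l, r x = x) ∧ ∀ x, x ∈ a :: l ↔ π.SameCycle a x := by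
  by_cases ha : a ∈ π.support
  · obtain ⟨l, hl⟩ : ∃ l, π.toList a = a :: l := by
      have h0 := toList_getElem_zero π a ha
      cases h : π.toList a with
      | nil => exact absurd ha (toList_eq_nil_iff.mp h)
      | cons c l => simp only [h, List.getElem_cons_zero] at h0; exact ⟨l, by rw [h0]⟩
    have hmem : ∀ x, x ∈ a :: l ↔ π.SameCycle a x := fun x => by
      rw [← hl, mem_toList_iff]; exact and_iff_left ha
    refine ⟨l, (a :: l).formPerm⁻¹ * π, hl ▸ nodup_toList π a, by simp, fun x hx => ?_, hmem⟩
    rw [Perm.mul_apply, Perm.inv_eq_iff_eq, ← hl, formPerm_toList,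
      ((hmem x).mp hx).cycleOf_apply]
  · have ha' : π a = a := by simpa using ha
    refine ⟨[], π, by simp, by simp, by simpa using ha', fun x => ?_⟩
    simp only [List.mem_singleton]
    constructor
    · rintro rfl; rfl
    · exact fun h => (h.eq_of_left ha').symm

lemma cycleType_formPerm_mul (a : α) (l : List α) (r : Perm α) (hl : (a :: l).Nodup)
    (hr : ∀ x ∈ a :: l, r x = x) :
    ((a :: l).formPerm * r).cycleType =
      (if l = [] then 0 else {l.length + 1}) + r.cycleType := by
  have hd : Perm.Disjoint (a :: l).formPerm r := fun x => by
    by_cases hx : x ∈ a :: l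
    · exact Or.inr (hr x hx)
    · exact Or.inl (List.formPerm_apply_of_notMem hx)
  rw [hd.cycleType_mul]
  split_ifs with h
  · simp [h]
  · have h2 : 2 ≤ (a :: l).length := by
      have := List.length_pos_iff.mpr h
      simp only [List.length_cons]; omega
    have hsup : ((a :: l).formPerm).support = (a :: l).toFinset :=
      List.support_formPerm_of_nodup _ hl fun x hx => by simp [hx] at h2
    rw [(List.isCycle_formPerm hl h2).cycleType, hsup, List.toFinset_card_of_nodup hl,
      List.length_cons]

/-- The product of the weights of the cycles of `π`. -/
def permWeight (π : Perm α) : ℚ := (π.cycleType.map cycleWeight).prod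

/-- The least number of transpositions with product `π`. -/
def reflLength (π : Perm α) : ℕ := (π.cycleType.map (· - 1)).sum

lemma permWeight_formPerm_mul (a : α) (l : List α) (r : Perm α) (hl : (a :: l).Nodup)
    (hr : ∀ x ∈ a :: l, r x = x) :
    permWeight ((a :: l).formPerm * r) = cycleWeight (l.length + 1) * permWeight r := by
  rw [permWeight, cycleType_formPerm_mul a l r hl hr]
  split_ifs with h
  · rw [h, List.length_nil, zero_add, zero_add, show cycleWeight 1 = 1 by simp [cycleWeight],
      one_mul, permWeight]
  · simp [permWeight]

lemma reflLength_formPerm_mul (a : α) (l : List α) (r : Perm α) (hl : (a :: l).Nodup)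
    (hr : ∀ x ∈ a :: l, r x = x) :
    reflLength ((a :: l).formPerm * r) = l.length + reflLength r := by
  rw [reflLength, cycleType_formPerm_mul a l r hl hr]
  split_ifs with h
  · simp [h, reflLength]
  · simp [reflLength]

lemma swap_mul_formPerm_mul (a : α) (l₁ : List α) (b : α) (l₂ : List α) (r : Perm α)
    (h : (a :: (l₁ ++ b :: l₂)).Nodup) (hr : ∀ x ∈ a :: (l₁ ++ b :: l₂), r x = x) :
    permWeight (swap a b * ((a :: (l₁ ++ b :: l₂)).formPerm * r)) =
        cycleWeight (l₁.length + 1) * cycleWeight (l₂.length + 1) * permWeight r ∧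
      reflLength (swap a b * ((a :: (l₁ ++ b :: l₂)).formPerm * r)) =
        l₁.length + l₂.length + reflLength r := by
  rw [formPerm_cons_append_cons a l₁ b l₂ h]
  have e : swap a b * (swap a b * ((a :: l₁).formPerm * (b :: l₂).formPerm) * r) =
      (a :: l₁).formPerm * ((b :: l₂).formPerm * r) := by
    simp [mul_assoc]
  have h₁ : (a :: l₁).Nodup := by
    rw [← List.cons_append] at h; exact h.of_append_left
  have h₂ : (b :: l₂).Nodup := by
    rw [← List.cons_append] at h; exact h.of_append_right
  have hd : List.Disjoint (a :: l₁) (b :: l₂) := by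
    rw [← List.cons_append] at h; exact List.disjoint_of_nodup_append h
  have hr₂ : ∀ x ∈ b :: l₂, r x = x := fun x hx => hr x (by
    rw [← List.cons_append]; exact List.mem_append_right _ hx)
  have hr₁ : ∀ x ∈ a :: l₁, ((b :: l₂).formPerm * r) x = x := fun x hx => by
    rw [Perm.mul_apply, hr x (by rw [← List.cons_append]; exact List.mem_append_left _ hx),
      List.formPerm_apply_of_notMem (hd hx)]
  rw [e, permWeight_formPerm_mul a l₁ _ h₁ hr₁, permWeight_formPerm_mul b l₂ _ h₂ hr₂,
    reflLength_formPerm_mul a l₁ _ h₁ hr₁, reflLength_formPerm_mul b l₂ _ h₂ hr₂]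
  exact ⟨by ring, by ring⟩

lemma reflLength_swap_mul_of_not_sameCycle (π : Perm α) (a b : α) (hab : ¬ π.SameCycle a b) :
    reflLength (swap a b * π) = reflLength π + 1 := by
  obtain ⟨l, r, hl, hπ, hr, hmem⟩ := exists_formPerm_mul π a
  obtain ⟨l', r', hl', rfl, hr', hmem'⟩ := exists_formPerm_mul r b
  have hd : ∀ x ∈ a :: l, x ∉ b :: l' := fun x hx hx' => by
    have : b = x := ((hmem' x).mp hx').eq_of_right (hr x hx)
    exact hab ((hmem b).mp (this ▸ hx))
  have hr₁ : ∀ x ∈ a :: l, r' x = x := fun x hx => by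
    have h1 := hr x hx
    rw [Perm.mul_apply, ← Perm.eq_inv_iff_eq] at h1
    rw [h1, Perm.inv_eq_iff_eq, List.formPerm_apply_of_notMem (hd x hx)]
  have hn : (a :: (l ++ b :: l')).Nodup := by
    rw [← List.cons_append]
    exact List.Nodup.append hl hl' hd
  have e : swap a b * π = (a :: (l ++ b :: l')).formPerm * r' := by
    rw [formPerm_cons_append_cons a l b l' hn, hπ]; simp only [mul_assoc]
  rw [e, reflLength_formPerm_mul _ _ _ hn, hπ, reflLength_formPerm_mul _ _ _ hl hr,
    reflLength_formPerm_mul _ _ _ hl' hr']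
  · simp only [List.length_append, List.length_cons]; ring
  · intro x hx
    rw [← List.cons_append, List.mem_append] at hx
    exact hx.elim (hr₁ x) (hr' x)

lemma reflLength_le_reflLength_swap_mul (π : Perm α) (a b : α) :
    reflLength π ≤ reflLength (swap a b * π) + 1 := by
  by_cases hab : π.SameCycle a b
  · obtain ⟨l, r, hl, hπ, hr, hmem⟩ := exists_formPerm_mul π a
    rcases List.mem_cons.mp ((hmem b).mpr hab) with rfl | hb
    · rw [swap_self, ← Perm.one_def, one_mul]; omega
    · obtain ⟨l₁, l₂, rfl⟩ := List.append_of_mem hb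
      rw [hπ, (swap_mul_formPerm_mul a l₁ b l₂ r hl hr).2, reflLength_formPerm_mul _ _ _ hl hr]
      simp only [List.length_append, List.length_cons]; omega
  · rw [reflLength_swap_mul_of_not_sameCycle π a b hab]; omega

lemma reflLength_eq_zero_iff (π : Perm α) : reflLength π = 0 ↔ π = 1 := by
  rw [reflLength, Multiset.sum_eq_zero_iff, ← cycleType_eq_zero]
  constructor
  · intro h
    refine Multiset.eq_zero_of_forall_notMem fun d hd => ?_
    have := two_le_of_mem_cycleType hd
    have := h (d - 1) (Multiset.mem_map_of_mem _ hd)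
    omega
  · intro h; simp [h]

/-- The number of points on the cycle of `π` through `a`. -/
def cycleLength (π : Perm α) (a : α) : ℕ := (Finset.univ.filter (π.SameCycle a)).card

lemma sum_cycleLength (π : Perm α) :
    ∑ a, ((cycleLength π a : ℚ) - 1) / cycleLength π a = reflLength π := by
  have hfix : ∀ a ∈ Finset.univ, a ∉ π.support →
      ((cycleLength π a : ℚ) - 1) / cycleLength π a = 0 := by
    intro a _ ha
    have : cycleLength π a = 1 := by
      rw [cycleLength, Finset.card_eq_one]
      refine ⟨a, Finset.ext fun x => ?_⟩
      simp only [Finset.mem_filter, Finset.mem_univ, true_and, Finset.mem_singleton]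
      constructor
      · exact fun h => (h.eq_of_left (by simpa [Function.IsFixedPt] using ha)).symm
      · rintro rfl; rfl
    simp [this]
  have hmaps : ∀ a ∈ π.support, π.cycleOf a ∈ π.cycleFactorsFinset := fun a ha =>
    cycleOf_mem_cycleFactorsFinset_iff.mpr ha
  rw [← Finset.sum_subset (Finset.subset_univ π.support) hfix,
    ← Finset.sum_fiberwise_of_maps_to hmaps, reflLength, cycleType_def, Multiset.map_map]
  change _ = ((∑ c ∈ π.cycleFactorsFinset, (c.support.card - 1) : ℕ) : ℚ)
  rw [Nat.cast_sum]
  refine Finset.sum_congr rfl fun c hc => ?_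
  have hcyc := (mem_cycleFactorsFinset_iff.mp hc).1
  have hpos := hcyc.two_le_card_support
  have hfib : π.support.filter (fun a => π.cycleOf a = c) = c.support := by
    ext x
    rw [Finset.mem_filter]
    constructor
    · rintro ⟨hx, rfl⟩
      rw [mem_support_cycleOf_iff]; exact ⟨SameCycle.refl _ _, hx⟩
    · exact fun hx => ⟨mem_cycleFactorsFinset_support_le hc hx,
        (cycle_is_cycleOf hx hc).symm⟩
  have hlen : ∀ a ∈ c.support, cycleLength π a = c.support.card := by
    intro a ha
    have hca := cycle_is_cycleOf ha hc
    have hsa := mem_cycleFactorsFinset_support_le hc ha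
    rw [cycleLength]
    congr 1
    ext x
    rw [hca, mem_support_cycleOf_iff]
    simp [hsa]
  rw [hfib, Finset.sum_congr rfl fun a ha => by rw [hlen a ha], Finset.sum_const, nsmul_eq_mul,
    Nat.cast_sub (by omega)]
  have : (c.support.card : ℚ) ≠ 0 := by positivity
  field_simp
  simp

lemma sum_permWeight_swap_mul (π : Perm α) (a : α) (m : ℕ) (hm : reflLength π = m + 1)
    (f : Perm α → ℚ) (hf₀ : ∀ σ, m < reflLength σ → f σ = 0)
    (hf : ∀ σ, reflLength σ = m → f σ = m ! * permWeight σ) :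
    ∑ b ∈ Finset.univ.erase a, f (swap a b * π) =
      2 * m ! * permWeight π * (((cycleLength π a : ℚ) - 1) / cycleLength π a) := by
  obtain ⟨l, r, hl, hπ, hr, hmem⟩ := exists_formPerm_mul π a
  have hlen : cycleLength π a = l.length + 1 := by
    rw [cycleLength, ← List.length_cons (a := a), ← List.toFinset_card_of_nodup hl]
    congr 1
    ext x
    simp [← hmem]
  have hal : a ∉ l := (List.nodup_cons.mp hl).1
  have hsub : l.toFinset ⊆ Finset.univ.erase a := fun x hx => by
    rw [List.mem_toFinset] at hx
    exact Finset.mem_erase.mpr ⟨fun h => hal (h ▸ hx), Finset.mem_univ _⟩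
  rw [← Finset.sum_subset hsub, sum_toFinset_of_forall_append l (List.nodup_cons.mp hl).2 _
    (fun i => m ! * permWeight r * (cycleWeight (i + 1) * cycleWeight (l.length - i))),
    ← Finset.mul_sum, sum_cycleWeight_mul_cycleWeight, hlen, hπ,
    permWeight_formPerm_mul _ _ _ hl hr]
  · push_cast
    ring
  · rintro l₁ b l₂ rfl
    obtain ⟨hw, hc⟩ := swap_mul_formPerm_mul a l₁ b l₂ r hl hr
    rw [hπ, reflLength_formPerm_mul _ _ _ hl hr, List.length_append, List.length_cons] at hm
    rw [hπ, hf _ (by rw [hc]; omega), hw, List.length_append, List.length_cons,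
      Nat.add_sub_cancel_left]
    ring
  · intro b hb hbl
    apply hf₀
    rw [reflLength_swap_mul_of_not_sameCycle]
    · omega
    · rw [← hmem, List.mem_cons, not_or]
      exact ⟨(Finset.mem_erase.mp hb).1, by simpa using hbl⟩

/-- The number of factorizations of `π` into `m` transpositions. -/
noncomputable def factorizationCount (m : ℕ) (π : Perm α) : ℕ :=
  Nat.card {ρ : Fin m → Perm α // (∀ i, (ρ i).IsSwap) ∧ (List.ofFn ρ).prod = π}

lemma factorizationCount_zero (π : Perm α) :
    factorizationCount 0 π = if π = 1 then 1 else 0 := by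
  rw [factorizationCount]
  split_ifs with h
  · subst h
    rw [Nat.card_eq_one_iff_unique]
    exact ⟨inferInstance, ⟨⟨Fin.elim0, fun i => i.elim0, by simp⟩⟩⟩
  · rw [Nat.card_eq_zero]
    exact Or.inl ⟨fun ⟨ρ, _, hρ⟩ => h (by simpa using hρ.symm)⟩

/-- A factorization is its first factor followed by a factorization of the quotient. -/
def factorizationConsEquiv (m : ℕ) (π : Perm α) :
    {ρ : Fin (m + 1) → Perm α // (∀ i, (ρ i).IsSwap) ∧ (List.ofFn ρ).prod = π} ≃
      Σ τ : {τ : Perm α // τ.IsSwap},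
        {ρ : Fin m → Perm α // (∀ i, (ρ i).IsSwap) ∧ (List.ofFn ρ).prod = τ.1⁻¹ * π} where
  toFun ρ := ⟨⟨ρ.1 0, ρ.2.1 0⟩, ⟨fun i => ρ.1 i.succ, fun i => ρ.2.1 i.succ, by
    rw [eq_inv_mul_iff_mul_eq, ← List.prod_cons, ← List.ofFn_succ]; exact ρ.2.2⟩⟩
  invFun p := ⟨Fin.cons p.1.1 p.2.1, Fin.cases p.1.2 p.2.2.1, by
    simp [List.ofFn_succ, p.2.2.2]⟩
  left_inv ρ := Subtype.ext (Fin.cons_self_tail ρ.1)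
  right_inv p := rfl

lemma two_mul_factorizationCount_succ (m : ℕ) (π : Perm α) :
    2 * factorizationCount (m + 1) π =
      ∑ a, ∑ b ∈ Finset.univ.erase a, factorizationCount m (swap a b * π) := by
  classical
  have hcons : factorizationCount (m + 1) π =
      ∑ τ ∈ Finset.univ.filter (fun τ : Perm α => τ.IsSwap), factorizationCount m (τ⁻¹ * π) := by
    rw [factorizationCount, Nat.card_congr (factorizationConsEquiv m π), Nat.card_sigma,
      Finset.sum_subtype (p := fun τ : Perm α => τ.IsSwap) _ (by simp)]
    rfl
  have hpairs : ∀ F : Perm α → ℕ, ∑ p ∈ Finset.univ.offDiag, F (swap (p : α × α).1 p.2) =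
      2 * ∑ τ ∈ Finset.univ.filter (fun τ : Perm α => τ.IsSwap), F τ := by
    intro F
    have hmaps : ∀ p ∈ (Finset.univ : Finset α).offDiag,
        swap p.1 p.2 ∈ Finset.univ.filter (fun τ : Perm α => τ.IsSwap) := by
      intro p hp
      simp only [Finset.mem_filter, Finset.mem_univ, true_and]
      exact ⟨p.1, p.2, (Finset.mem_offDiag.mp hp).2.2, rfl⟩
    rw [← Finset.sum_fiberwise_of_maps_to hmaps, Finset.mul_sum]
    refine Finset.sum_congr rfl fun τ hτ => ?_
    obtain ⟨x, y, hxy, rfl⟩ := (Finset.mem_filter.mp hτ).2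
    have hfib : (Finset.univ : Finset α).offDiag.filter (fun p => swap p.1 p.2 = swap x y) =
        {(x, y), (y, x)} := by
      ext ⟨a, b⟩
      simp only [Finset.mem_filter, Finset.mem_offDiag, Finset.mem_univ, true_and,
        Finset.mem_insert, Finset.mem_singleton, Prod.mk.injEq]
      constructor
      · rintro ⟨hab, h⟩
        have h1 := congrArg (fun σ : Perm α => σ a) h
        have h2 := congrArg (fun σ : Perm α => σ b) h
        simp only [swap_apply_left, swap_apply_right, swap_apply_def] at h1 h2
        grind
      · rintro (⟨rfl, rfl⟩ | ⟨rfl, rfl⟩)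
        · exact ⟨hxy, rfl⟩
        · exact ⟨hxy.symm, swap_comm _ _⟩
    rw [Finset.sum_congr rfl fun p hp => by rw [(Finset.mem_filter.mp hp).2], hfib,
      Finset.sum_const, Finset.card_pair (by simp [hxy]), smul_eq_mul]
  rw [hcons, ← hpairs fun τ => factorizationCount m (τ⁻¹ * π), Finset.sum_sigma']
  refine Finset.sum_nbij' (fun p => ⟨p.1, p.2⟩) (fun p => (p.1, p.2)) ?_ ?_ ?_ ?_ ?_
  · rintro ⟨a, b⟩ h; simpa [eq_comm] using h
  · rintro ⟨a, b⟩ h; simpa [eq_comm] using h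
  · simp
  · simp
  · simp

/-- Counts the factorizations of `π` into the least number of transpositions. -/
theorem factorizationCount_eq (m : ℕ) (π : Perm α) :
    (m < reflLength π → factorizationCount m π = 0) ∧
      (reflLength π = m → (factorizationCount m π : ℚ) = m ! * permWeight π) := by
  induction m generalizing π with
  | zero =>
    refine ⟨fun h => ?_, fun h => ?_⟩
    · rw [factorizationCount_zero, if_neg]
      exact fun h1 => h.ne' ((reflLength_eq_zero_iff π).mpr h1)
    · rw [reflLength_eq_zero_iff] at h
      simp [h, factorizationCount_zero, permWeight]
  | succ m ih =>
    have hrec := two_mul_factorizationCount_succ m π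
    refine ⟨fun h => ?_, fun h => ?_⟩
    · rw [Finset.sum_eq_zero fun a _ => Finset.sum_eq_zero fun b _ => (ih _).1 ?_] at hrec
      · omega
      · have := reflLength_le_reflLength_swap_mul π a b
        omega
    · have hrec' : (2 : ℚ) * factorizationCount (m + 1) π =
          ∑ a, ∑ b ∈ Finset.univ.erase a, (factorizationCount m (swap a b * π) : ℚ) := by
        exact_mod_cast hrec
      simp_rw [fun a => sum_permWeight_swap_mul π a m h (fun σ => factorizationCount m σ)
        (fun σ hσ => by simp [(ih σ).1 hσ]) (fun σ hσ => (ih σ).2 hσ)] at hrec'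
      rw [← Finset.mul_sum, sum_cycleLength, h] at hrec'
      rw [Nat.factorial_succ]
      push_cast at hrec' ⊢
      linear_combination hrec' / 2

end

/-- The number of ways to write a fixed `n`-cycle `ζ` in `S_n` (a
permutation whose powers act transitively on the `n` points) as an ordered product of
`n - 1` transpositions is `n^{n-2}`. -/
theorem card_minimal_factorizations_of_cycle {n : ℕ} (ζ : Equiv.Perm (Fin n))
    (hζ : ∀ a b : Fin n, ∃ k : ℕ, (ζ ^ k) a = b) :
    Nat.card {ρ : Fin (n - 1) → Equiv.Perm (Fin n) //
      (∀ i, (ρ i).IsSwap) ∧ (List.ofFn ρ).prod = ζ} = n ^ (n - 2) := by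
  change factorizationCount (n - 1) ζ = _
  rcases n with _ | n
  · rw [Nat.zero_sub, factorizationCount_zero, if_pos (Subsingleton.elim _ _)]
    rfl
  obtain ⟨l, r, hl, hπ, hr, hmem⟩ := exists_formPerm_mul ζ 0
  have hall : ∀ x, x ∈ 0 :: l := fun x => by
    obtain ⟨k, hk⟩ := hζ 0 x
    exact (hmem x).mpr ⟨k, by simpa using hk⟩
  have hr1 : r = 1 := Equiv.ext fun x => hr x (hall x)
  have hlen : l.length = n := by
    have h := List.toFinset_card_of_nodup hl
    rw [Finset.eq_univ_of_forall fun x => List.mem_toFinset.mpr (hall x), Finset.card_univ,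
      Fintype.card_fin, List.length_cons] at h
    omega
  have hw := permWeight_formPerm_mul 0 l r hl hr
  have hc := reflLength_formPerm_mul 0 l r hl hr
  rw [← hπ, hlen, hr1] at hw hc
  have hcount := (factorizationCount_eq n ζ).2 (by
    rw [hc, (reflLength_eq_zero_iff 1).mpr rfl, add_zero])
  rw [Nat.add_sub_cancel, ← Nat.cast_inj (R := ℚ), hcount, hw]
  simp only [permWeight, cycleType_one, Multiset.map_zero, Multiset.prod_zero, mul_one,
    cycleWeight, Nat.add_sub_cancel, Nat.factorial_succ]
  rcases n with _ | n
  · simp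
  have hf : ((n + 1)! : ℚ) ≠ 0 := by positivity
  rw [show n + 1 + 1 - 2 = n by omega, pow_succ]
  push_cast
  field_simp
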